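/- arXiv:2210.11790 — 4 statements merged into one kernel-verified Lean document; each statement's English description precedes it below -/
import Mathlib

section
/- Let L be an n×n real symmetric positive semidefinite matrix whose smallest eigenvalue is 0, and let 0 = λ_1 ≤ λ_2 ≤ … ≤ λ_n denote its eigenvalues listed with multiplicity in ascending order. Let α ≥ 0 be a real number satisfying α(λ_2 + λ_n) ≤ 2. Then for every real n×p matrix X, tr(Xᵀ L (I − αL)² X) ≤ (1 − αλ_2)² · tr(Xᵀ L X). -/
open Matrix

/-- The trace of a quadratic form in diagonalized shape. -/
theorem trace_transpose_mul_diagonalized_mul {m k : Type*} [Fintype m] [DecidableEq m] [Fintype k]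
    (U : Matrix m m ℝ) (ν : m → ℝ) (X : Matrix m k ℝ) :
    trace (Xᵀ * (U * diagonal ν * Uᵀ) * X) = ∑ i, ν i * ∑ j, (Uᵀ * X) i j ^ 2 := by
  have h : Xᵀ * (U * diagonal ν * Uᵀ) * X = (Uᵀ * X)ᵀ * (diagonal ν * (Uᵀ * X)) := by
    simp only [transpose_mul, transpose_transpose, Matrix.mul_assoc]
  rw [h]
  simp only [trace, diag_apply, mul_apply (M := (Uᵀ * X)ᵀ), diagonal_mul, transpose_apply]
  rw [Finset.sum_comm]
  refine Finset.sum_congr rfl fun i _ => ?_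
  rw [Finset.mul_sum]
  exact Finset.sum_congr rfl fun j _ => by ring

/-- The filter `L (1 - αL)²` acts on each eigenvalue separately. -/
theorem diagonalized_mul_one_sub_smul_sq {m : Type*} [Fintype m] [DecidableEq m]
    (U : Matrix m m ℝ) (hU : Uᵀ * U = 1) (μ : m → ℝ) (α : ℝ) :
    (U * diagonal μ * Uᵀ) * (1 - α • (U * diagonal μ * Uᵀ)) ^ 2 =
      U * diagonal (fun i => μ i * (1 - α * μ i) ^ 2) * Uᵀ := by
  have conj_mul (a b : m → ℝ) : (U * diagonal a * Uᵀ) * (U * diagonal b * Uᵀ) =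
      U * diagonal (fun i => a i * b i) * Uᵀ := by
    rw [← diagonal_mul_diagonal, show (U * diagonal a * Uᵀ) * (U * diagonal b * Uᵀ) =
      U * diagonal a * (Uᵀ * U) * diagonal b * Uᵀ by simp only [Matrix.mul_assoc], hU]
    simp only [Matrix.mul_one, Matrix.mul_assoc]
  have one_sub : 1 - α • (U * diagonal μ * Uᵀ) = U * diagonal (fun i => 1 - α * μ i) * Uᵀ := by
    have hd : diagonal (fun i => 1 - α * μ i) = 1 - α • diagonal μ := by
      rw [← diagonal_one, ← diagonal_smul, diagonal_sub]
      rfl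
    rw [hd, Matrix.mul_sub, Matrix.sub_mul, Matrix.mul_one, mul_eq_one_comm.mp hU,
      Matrix.mul_smul, Matrix.smul_mul]
  rw [one_sub, pow_two, conj_mul, conj_mul]
  simp only [pow_two]

/-- Let `L` be an `n × n` real symmetric positive semidefinite matrix whose
smallest eigenvalue is `0`, with eigenvalues `0 = λ₁ ≤ λ₂ ≤ … ≤ λₙ` listed with multiplicity in
ascending order (encoded via an orthogonal diagonalization `L = U * diagonal μ * Uᵀ` with `μ`
monotone and `μ 0 = 0`).  Let `α ≥ 0` satisfy `α (λ₂ + λₙ) ≤ 2`.  Then for every real `n × p`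
matrix `X`, `tr (Xᵀ L (I - αL)² X) ≤ (1 - α λ₂)² ⬝ tr (Xᵀ L X)`. -/
theorem dirichlet_energy_decay {n p : ℕ}
    (L U : Matrix (Fin (n + 2)) (Fin (n + 2)) ℝ)
    (μ : Fin (n + 2) → ℝ)
    (hU : Uᵀ * U = 1)
    (hL : L = U * Matrix.diagonal μ * Uᵀ)
    (hmono : Monotone μ)
    (hμ0 : μ 0 = 0)
    (α : ℝ) (hα : 0 ≤ α)
    (hα2 : α * (μ 1 + μ (Fin.last (n + 1))) ≤ 2)
    (X : Matrix (Fin (n + 2)) (Fin p) ℝ) :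
    Matrix.trace (Xᵀ * L * (1 - α • L) ^ 2 * X) ≤
      (1 - α * μ 1) ^ 2 * Matrix.trace (Xᵀ * L * X) := by
  rw [Matrix.mul_assoc Xᵀ L, hL, diagonalized_mul_one_sub_smul_sq U hU,
    trace_transpose_mul_diagonalized_mul, trace_transpose_mul_diagonalized_mul, Finset.mul_sum]
  refine Finset.sum_le_sum fun i _ => ?_
  rw [← mul_assoc]
  refine mul_le_mul_of_nonneg_right ?_ (Finset.sum_nonneg fun j _ => sq_nonneg _)
  rcases eq_or_ne i 0 with rfl | hi
  · simp [hμ0]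
  · have hμi : 0 ≤ μ i := hμ0 ▸ hmono (Fin.zero_le i)
    have hlow : α * μ 1 ≤ α * μ i :=
      mul_le_mul_of_nonneg_left (hmono (Fin.one_le_of_ne_zero hi)) hα
    have hhigh : α * μ i ≤ α * μ (Fin.last (n + 1)) :=
      mul_le_mul_of_nonneg_left (hmono (Fin.le_last i)) hα
    rw [mul_comm]
    refine mul_le_mul_of_nonneg_right (sq_le_sq' ?_ ?_) hμi <;> linarith
end

section
/- Let L be an n×n real symmetric positive semidefinite matrix (n ≥ 2) whose smallest eigenvalue is 0, with eigenvalues 0 = λ_1 ≤ λ_2 ≤ … ≤ λ_n listed with multiplicity in ascending order, and assume λ_2 > 0. Let α ≥ 0 satisfy α(λ_2 + λ_n) ≤ 2, and let p ≥ 1. Then (1 − αλ_2)² is the greatest element of the set { tr(Xᵀ L (I − αL)² X) / tr(Xᵀ L X) : X ∈ ℝ^{n×p}, tr(Xᵀ L X) ≠ 0 }; in particular the supremum is attained, e.g. at X = v eᵀ where v is a unit eigenvector of L for λ_2 and e ∈ ℝ^p is any nonzero vector. -/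
open Matrix

theorem Matrix.trace_transpose_mul_conj_diagonal_mul {m k : Type*} [Fintype m] [DecidableEq m]
    [Fintype k] (U : Matrix m m ℝ) (d : m → ℝ) (X : Matrix m k ℝ) :
    trace (Xᵀ * (U * diagonal d * Uᵀ) * X) = ∑ i, d i * ∑ j, (Uᵀ * X) i j ^ 2 := by
  have h : Xᵀ * (U * diagonal d * Uᵀ) * X = (Uᵀ * X)ᵀ * (diagonal d * (Uᵀ * X)) := by
    simp only [transpose_mul, transpose_transpose, Matrix.mul_assoc]
  rw [h]
  generalize Uᵀ * X = Y
  simp only [trace, diag_apply, mul_apply (M := Yᵀ), diagonal_mul, transpose_apply]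
  rw [Finset.sum_comm]
  refine Finset.sum_congr rfl fun i _ => ?_
  rw [Finset.mul_sum]
  exact Finset.sum_congr rfl fun j _ => by ring

theorem Matrix.conj_diagonal_mul_one_sub_smul_sq {m : Type*} [Fintype m] [DecidableEq m]
    {U : Matrix m m ℝ} (hU : Uᵀ * U = 1) (d : m → ℝ) (α : ℝ) :
    (U * diagonal d * Uᵀ) * (1 - α • (U * diagonal d * Uᵀ)) ^ 2 =
      U * diagonal (fun i => d i * (1 - α * d i) ^ 2) * Uᵀ := by
  have hU' : U * Uᵀ = 1 := mul_eq_one_comm.mp hU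
  have conj_mul (a b : m → ℝ) : (U * diagonal a * Uᵀ) * (U * diagonal b * Uᵀ) =
      U * diagonal (fun i => a i * b i) * Uᵀ := by
    rw [← diagonal_mul_diagonal]
    calc _ = U * diagonal a * (Uᵀ * U) * diagonal b * Uᵀ := by simp only [Matrix.mul_assoc]
      _ = _ := by rw [hU, Matrix.mul_one]; simp only [Matrix.mul_assoc]
  have h : 1 - α • (U * diagonal d * Uᵀ) = U * diagonal (fun i => 1 - α * d i) * Uᵀ := by
    have hd : diagonal (fun i => 1 - α * d i) = 1 - α • diagonal d := by
      rw [← diagonal_one, ← diagonal_smul, ← diagonal_sub]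
      rfl
    rw [hd, Matrix.mul_sub, Matrix.sub_mul, Matrix.mul_one, hU', Matrix.mul_smul, Matrix.smul_mul]
  rw [h, pow_two, conj_mul, conj_mul]
  simp only [pow_two]

theorem Matrix.trace_transpose_vecMulVec_mul_vecMulVec {m k : Type*} [Fintype m] [Fintype k]
    (v : m → ℝ) (e : k → ℝ) :
    trace ((vecMulVec v e)ᵀ * vecMulVec v e) = (∑ i, v i ^ 2) * ∑ j, e j ^ 2 := by
  simp only [trace, diag_apply, mul_apply, transpose_apply, vecMulVec_apply]
  rw [Finset.sum_comm, Finset.sum_mul]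
  refine Finset.sum_congr rfl fun i _ => ?_
  rw [Finset.mul_sum]
  exact Finset.sum_congr rfl fun j _ => by ring

theorem energy_ratio_of_eigenvector {m k : Type*} [Fintype m] [DecidableEq m] [Fintype k]
    {L : Matrix m m ℝ} {l : ℝ} (hl : l ≠ 0) (α : ℝ) {v : m → ℝ} {e : k → ℝ}
    (hv : L.mulVec v = l • v) (hv1 : (∑ i, v i ^ 2) = 1) (he : e ≠ 0) :
    trace ((vecMulVec v e)ᵀ * L * vecMulVec v e) ≠ 0 ∧
      trace ((vecMulVec v e)ᵀ * L * (1 - α • L) ^ 2 * vecMulVec v e) /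
        trace ((vecMulVec v e)ᵀ * L * vecMulVec v e) = (1 - α * l) ^ 2 := by
  have hLV : L * vecMulVec v e = l • vecMulVec v e := by
    rw [mul_vecMulVec, hv, smul_vecMulVec]
  have hNV : (1 - α • L) * vecMulVec v e = (1 - α * l) • vecMulVec v e := by
    rw [Matrix.sub_mul, Matrix.smul_mul, hLV, Matrix.one_mul, smul_smul, sub_smul, one_smul]
  have he' : (∑ j, e j ^ 2) ≠ 0 := by
    contrapose! he
    rw [Finset.sum_eq_zero_iff_of_nonneg fun j _ => sq_nonneg (e j)] at he
    funext j
    simpa using he j (Finset.mem_univ j)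
  have h₁ : trace ((vecMulVec v e)ᵀ * L * vecMulVec v e) = l * ∑ j, e j ^ 2 := by
    rw [Matrix.mul_assoc, hLV, Matrix.mul_smul, trace_smul,
      trace_transpose_vecMulVec_mul_vecMulVec, hv1, one_mul, smul_eq_mul]
  have h₂ : trace ((vecMulVec v e)ᵀ * L * (1 - α • L) ^ 2 * vecMulVec v e) =
      (1 - α * l) ^ 2 * (l * ∑ j, e j ^ 2) := by
    rw [Matrix.mul_assoc, pow_two, Matrix.mul_assoc (1 - α • L), hNV, Matrix.mul_smul, hNV,
      smul_smul, Matrix.mul_smul, trace_smul, h₁, smul_eq_mul, pow_two]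
  rw [h₁, h₂]
  exact ⟨mul_ne_zero hl he', mul_div_cancel_right₀ _ (mul_ne_zero hl he')⟩

theorem one_sub_mul_sq_le {α a b c : ℝ} (hα : 0 ≤ α) (hab : a ≤ b) (hbc : b ≤ c)
    (h : α * (a + c) ≤ 2) : (1 - α * b) ^ 2 ≤ (1 - α * a) ^ 2 := by
  have h₁ : 0 ≤ α * (b - a) := mul_nonneg hα (sub_nonneg.mpr hab)
  have h₂ : 0 ≤ α * (c - b) := mul_nonneg hα (sub_nonneg.mpr hbc)
  nlinarith [mul_nonneg h₁ (show 0 ≤ 2 - α * (a + b) by linarith)]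

/-- Let `L` be an `n × n` (`n ≥ 2`) real symmetric positive semidefinite matrix
whose smallest eigenvalue is `0`, with eigenvalues `0 = λ₁ ≤ λ₂ ≤ … ≤ λₙ` in ascending order
(encoded via an orthogonal diagonalization with monotone `μ`, `μ 0 = 0`), and `λ₂ > 0`.
Let `α ≥ 0` satisfy `α (λ₂ + λₙ) ≤ 2` and let `p ≥ 1`.  Then `(1 - α λ₂)²` is the greatest
element of the set `{ tr (Xᵀ L (I - αL)² X) / tr (Xᵀ L X) : tr (Xᵀ L X) ≠ 0 }`; in particular
the supremum is attained, e.g. at `X = v eᵀ` for `v` a unit eigenvector of `L` for `λ₂` and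
`e ≠ 0`. -/
theorem energy_ratio_isGreatest {n p : ℕ}
    (L U : Matrix (Fin (n + 2)) (Fin (n + 2)) ℝ)
    (μ : Fin (n + 2) → ℝ)
    (hU : Uᵀ * U = 1)
    (hL : L = U * Matrix.diagonal μ * Uᵀ)
    (hmono : Monotone μ)
    (hμ0 : μ 0 = 0)
    (hμ2 : 0 < μ 1)
    (α : ℝ) (hα : 0 ≤ α)
    (hα2 : α * (μ 1 + μ (Fin.last (n + 1))) ≤ 2) :
    IsGreatest
      { r : ℝ | ∃ X : Matrix (Fin (n + 2)) (Fin (p + 1)) ℝ,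
          Matrix.trace (Xᵀ * L * X) ≠ 0 ∧
          r = Matrix.trace (Xᵀ * L * (1 - α • L) ^ 2 * X) / Matrix.trace (Xᵀ * L * X) }
      ((1 - α * μ 1) ^ 2) ∧
    ∀ (v : Fin (n + 2) → ℝ) (e : Fin (p + 1) → ℝ),
      L.mulVec v = μ 1 • v → (∑ i, v i ^ 2) = 1 → e ≠ 0 →
      Matrix.trace ((Matrix.vecMulVec v e)ᵀ * L * Matrix.vecMulVec v e) ≠ 0 ∧
      Matrix.trace ((Matrix.vecMulVec v e)ᵀ * L * (1 - α • L) ^ 2 * Matrix.vecMulVec v e) /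
          Matrix.trace ((Matrix.vecMulVec v e)ᵀ * L * Matrix.vecMulVec v e) =
        (1 - α * μ 1) ^ 2 := by
  have heig : ∀ (v : Fin (n + 2) → ℝ) (e : Fin (p + 1) → ℝ),
      L.mulVec v = μ 1 • v → (∑ i, v i ^ 2) = 1 → e ≠ 0 → _ :=
    fun v e hv hv1 he => energy_ratio_of_eigenvector hμ2.ne' α hv hv1 he
  refine ⟨⟨?_, ?_⟩, heig⟩
  · have hv : L.mulVec (U.col 1) = μ 1 • U.col 1 := by
      rw [hL, ← mulVec_single_one, mulVec_mulVec, Matrix.mul_assoc, hU, Matrix.mul_one,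
        ← mulVec_mulVec, ← mulVec_smul]
      congr 1
      ext i
      rcases eq_or_ne i 1 with rfl | hi <;> simp [mulVec_diagonal, *]
    have hv1 : (∑ i, U.col 1 i ^ 2) = 1 := by
      have := congrFun (congrFun hU 1) 1
      simpa [mul_apply, pow_two] using this
    obtain ⟨h₁, h₂⟩ := heig _ 1 hv hv1 one_ne_zero
    exact ⟨_, h₁, h₂.symm⟩
  · rintro r ⟨X, hX, rfl⟩
    have hμ (i) : 0 ≤ μ i := hμ0 ▸ hmono (Fin.zero_le i)
    have hE : trace (Xᵀ * L * X) = ∑ i, μ i * ∑ j, (Uᵀ * X) i j ^ 2 := by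
      rw [hL, trace_transpose_mul_conj_diagonal_mul]
    have hE' : trace (Xᵀ * L * (1 - α • L) ^ 2 * X) =
        ∑ i, μ i * (1 - α * μ i) ^ 2 * ∑ j, (Uᵀ * X) i j ^ 2 := by
      rw [Matrix.mul_assoc Xᵀ, hL, conj_diagonal_mul_one_sub_smul_sq hU,
        trace_transpose_mul_conj_diagonal_mul]
    have hY (i) : 0 ≤ ∑ j, (Uᵀ * X) i j ^ 2 := Finset.sum_nonneg fun j _ => sq_nonneg _
    have hpos : 0 < trace (Xᵀ * L * X) :=
      lt_of_le_of_ne (hE ▸ Finset.sum_nonneg fun i _ => mul_nonneg (hμ i) (hY i)) hX.symm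
    rw [div_le_iff₀ hpos, hE, hE', Finset.mul_sum]
    refine Finset.sum_le_sum fun i _ => ?_
    rcases eq_or_ne i 0 with rfl | hi
    · simp [hμ0]
    · have h := one_sub_mul_sq_le hα (hmono (Fin.one_le_of_ne_zero hi)) (hmono (Fin.le_last i)) hα2
      calc _ = (1 - α * μ i) ^ 2 * (μ i * ∑ j, (Uᵀ * X) i j ^ 2) := by ring
        _ ≤ _ := mul_le_mul_of_nonneg_right h (mul_nonneg (hμ i) (hY i))
end

section
/- Let A = A₁ + A₂, where A₁ and A₂ are n×n real symmetric {0,1}-matrices with zero diagonal and with A₁∘A₂ = 0 entrywise (the adjacency matrices of a graph 𝒢₁ and of the edges added in a rewiring, so A is the adjacency matrix of the rewired graph 𝒢₂). Assume every vertex of 𝒢₂ has positive degree, let D be the diagonal degree matrix of 𝒢₂, let L = I − D^{-1/2} A D^{-1/2} be the normalized Laplacian of 𝒢₂, and let 0 = λ_1 ≤ λ_2 ≤ … ≤ λ_n be its eigenvalues with multiplicity; assume λ_2 > 0. Let λ ∈ [0, λ_2] satisfy λ ≤ 1 and (λ/λ_2)(λ_2 + λ_n) ≤ 2. Then there exists α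 ∈ [0, 1] (namely α = λ/λ_2) such that the layer map φ(X) = (1 − α)X + α D^{-1/2} A₁ D^{-1/2} X + α D^{-1/2} A₂ D^{-1/2} X (i.e. φ(X) = (I − αL)X) satisfies: the set { 𝓔(φ(X))/𝓔(X) : 𝓔(X) ≠ 0 } has greatest element (1 − λ)², the set { ‖φ(X)‖_F²/‖X‖_F² : X ≠ 0 } has greatest element 1, and hence the rate of smoothing RS_{𝒢₂}(φ) = 1 − ( (1 − λ)² / 1 )^{1/2} equals λ. -/
open Matrix

/-- The Frobenius norm of a real matrix. -/
noncomputable def frobNorm {n p : ℕ} (X : Matrix (Fin n) (Fin p) ℝ) : ℝ :=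
  Real.sqrt (∑ i, ∑ j, X i j ^ 2)

lemma trace_transpose_mul_diagonal_conj {ι κ : Type*} [Fintype ι] [DecidableEq ι] [Fintype κ]
    (U : Matrix ι ι ℝ) (c : ι → ℝ) (X : Matrix ι κ ℝ) :
    trace (Xᵀ * (U * diagonal c * Uᵀ) * X) = ∑ i, c i * ∑ j, (Uᵀ * X) i j ^ 2 := by
  have h : Xᵀ * (U * diagonal c * Uᵀ) * X = (Uᵀ * X)ᵀ * (diagonal c * (Uᵀ * X)) := by
    simp only [transpose_mul, transpose_transpose, Matrix.mul_assoc]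
  rw [h, trace]
  simp only [diag_apply, mul_apply (M := (Uᵀ * X)ᵀ), diagonal_mul, transpose_apply (Uᵀ * X)]
  rw [Finset.sum_comm]
  refine Finset.sum_congr rfl fun i _ => ?_
  rw [Finset.mul_sum]
  exact Finset.sum_congr rfl fun j _ => by ring

lemma sum_sq_eq_trace {ι κ : Type*} [Fintype ι] [Fintype κ] (X : Matrix ι κ ℝ) :
    ∑ i, ∑ j, X i j ^ 2 = trace (Xᵀ * X) := by
  rw [Finset.sum_comm]
  simp [trace, mul_apply, sq]

lemma frobNorm_sq {n p : ℕ} (X : Matrix (Fin n) (Fin p) ℝ) :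
    frobNorm X ^ 2 = ∑ i, ∑ j, X i j ^ 2 :=
  Real.sq_sqrt (by positivity)

/-- The Frobenius norm is invariant under orthogonal transformations. -/
lemma frobNorm_sq_orthogonal {n p : ℕ} {U : Matrix (Fin n) (Fin n) ℝ} (hU : U * Uᵀ = 1)
    (X : Matrix (Fin n) (Fin p) ℝ) :
    frobNorm X ^ 2 = ∑ i, ∑ j, (Uᵀ * X) i j ^ 2 := by
  rw [frobNorm_sq, sum_sq_eq_trace, sum_sq_eq_trace, transpose_mul, transpose_transpose,
    Matrix.mul_assoc, ← Matrix.mul_assoc U, hU, Matrix.one_mul]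

/-- In an orthonormal eigenbasis, `1 - α L` acts by the scalars `1 - α μ i`. -/
lemma transpose_mul_one_sub_smul_mul_apply {ι κ : Type*} [Fintype ι] [DecidableEq ι]
    {U L : Matrix ι ι ℝ} {μ : ι → ℝ} (hU : Uᵀ * U = 1) (hL : L = U * diagonal μ * Uᵀ)
    (α : ℝ) (X : Matrix ι κ ℝ) (i : ι) (j : κ) :
    (Uᵀ * ((1 - α • L) * X) : Matrix ι κ ℝ) i j = (1 - α * μ i) * (Uᵀ * X) i j := by
  have h : Uᵀ * ((1 - α • L) * X) = Uᵀ * X - α • (diagonal μ * (Uᵀ * X)) := by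
    rw [hL, Matrix.sub_mul, Matrix.mul_sub, Matrix.one_mul, Matrix.smul_mul, Matrix.mul_smul]
    simp only [Matrix.mul_assoc]
    rw [← Matrix.mul_assoc Uᵀ U, hU, Matrix.one_mul]
  rw [h, Matrix.sub_apply, Matrix.smul_apply, diagonal_mul, smul_eq_mul]
  ring

lemma sum_single_sq {ι κ : Type*} [Fintype κ] [DecidableEq ι] [DecidableEq κ]
    (i₀ i : ι) (j₀ : κ) :
    ∑ j, single i₀ j₀ (1 : ℝ) i j ^ 2 = if i = i₀ then 1 else 0 := by
  by_cases h : i = i₀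
  · subst h
    simp [single_apply]
  · simp [h, Ne.symm h]

/-- **Theorem 1, rate of smoothing of a rewired R-GCN layer.**
Let `A = A₁ + A₂` with `A₁, A₂` symmetric `{0,1}`-matrices with zero diagonal and disjoint
supports (adjacency matrices of the original graph `𝒢₁` and of the added edges, so `A` is the
adjacency matrix of the rewired graph `𝒢₂`).  Assume all degrees of `𝒢₂` are positive, let
`D` be the degree matrix, `L = I - D^{-1/2} A D^{-1/2}` the normalized Laplacian of `𝒢₂` with
eigenvalues `0 = λ₁ ≤ λ₂ ≤ … ≤ λₙ` (encoded by an orthogonal diagonalization with monotone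
`μ`, `μ 0 = 0`), and `λ₂ > 0`.  Let `λ ∈ [0, λ₂]` with `λ ≤ 1` and `(λ/λ₂)(λ₂ + λₙ) ≤ 2`.
Then there is `α ∈ [0, 1]`, namely `α = λ/λ₂`, so that the R-GCN layer
`φ(X) = (1-α)X + α D^{-1/2}A₁D^{-1/2}X + α D^{-1/2}A₂D^{-1/2}X` equals `(I - αL)X`,
the set `{𝓔(φX)/𝓔(X) : 𝓔(X) ≠ 0}` has greatest element `(1-λ)²`, the set
`{‖φX‖_F²/‖X‖_F² : X ≠ 0}` has greatest element `1`, and hence the rate of smoothing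
`RS(φ) = 1 - ((1-λ)²/1)^{1/2}` equals `λ`. -/
theorem rgcn_rate_of_smoothing {n p : ℕ}
    (A₁ A₂ : Matrix (Fin (n + 2)) (Fin (n + 2)) ℝ)
    (h₁symm : A₁.IsSymm) (h₂symm : A₂.IsSymm)
    (h₁01 : ∀ i j, A₁ i j = 0 ∨ A₁ i j = 1)
    (h₂01 : ∀ i j, A₂ i j = 0 ∨ A₂ i j = 1)
    (h₁diag : ∀ i, A₁ i i = 0) (h₂diag : ∀ i, A₂ i i = 0)
    (hdisj : ∀ i j, A₁ i j * A₂ i j = 0)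
    (d : Fin (n + 2) → ℝ) (hd : ∀ i, d i = ∑ j, (A₁ + A₂) i j)
    (hdpos : ∀ i, 0 < d i)
    (Dhalf : Matrix (Fin (n + 2)) (Fin (n + 2)) ℝ)
    (hDhalf : Dhalf = Matrix.diagonal fun i => 1 / Real.sqrt (d i))
    (L : Matrix (Fin (n + 2)) (Fin (n + 2)) ℝ)
    (hLdef : L = 1 - Dhalf * (A₁ + A₂) * Dhalf)
    (U : Matrix (Fin (n + 2)) (Fin (n + 2)) ℝ) (μ : Fin (n + 2) → ℝ)
    (hU : Uᵀ * U = 1)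
    (hLdiag : L = U * Matrix.diagonal μ * Uᵀ)
    (hmono : Monotone μ) (hμ0 : μ 0 = 0) (hμ2 : 0 < μ 1)
    (lam : ℝ) (hlam : lam ∈ Set.Icc 0 (μ 1)) (hlam1 : lam ≤ 1)
    (hlam2 : lam / μ 1 * (μ 1 + μ (Fin.last (n + 1))) ≤ 2) :
    ∃ α ∈ Set.Icc (0 : ℝ) 1, α = lam / μ 1 ∧
      (∀ X : Matrix (Fin (n + 2)) (Fin (p + 1)) ℝ,
        (1 - α) • X + α • (Dhalf * A₁ * Dhalf * X) + α • (Dhalf * A₂ * Dhalf * X)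
          = (1 - α • L) * X) ∧
      IsGreatest
        { r : ℝ | ∃ X : Matrix (Fin (n + 2)) (Fin (p + 1)) ℝ,
            Matrix.trace (Xᵀ * L * X) ≠ 0 ∧
            r = Matrix.trace (((1 - α • L) * X)ᵀ * L * ((1 - α • L) * X)) /
                  Matrix.trace (Xᵀ * L * X) }
        ((1 - lam) ^ 2) ∧
      IsGreatest
        { r : ℝ | ∃ X : Matrix (Fin (n + 2)) (Fin (p + 1)) ℝ, X ≠ 0 ∧
            r = frobNorm ((1 - α • L) * X) ^ 2 / frobNorm X ^ 2 } 1 ∧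
      1 - Real.sqrt ((1 - lam) ^ 2 / 1) = lam := by
  have hU' : U * Uᵀ = 1 := mul_eq_one_comm.mp hU
  have hlam0 := hlam.1
  set α := lam / μ 1 with hα
  have hα0 : 0 ≤ α := div_nonneg hlam0 hμ2.le
  have hα1 : α ≤ 1 := (div_le_one hμ2).mpr hlam.2
  have hαμ : α * μ 1 = lam := div_mul_cancel₀ lam hμ2.ne'
  have hμ_nonneg (i) : 0 ≤ μ i := hμ0 ▸ hmono (Fin.zero_le i)
  have hfac {i : Fin (n + 2)} (hi : i ≠ 0) : (1 - α * μ i) ^ 2 ≤ (1 - lam) ^ 2 := by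
    have h₁ := mul_le_mul_of_nonneg_left (hmono (Fin.one_le_of_ne_zero hi)) hα0
    have h₂ := mul_le_mul_of_nonneg_left (hmono (Fin.le_last i)) hα0
    apply sq_le_sq'
    · linarith
    · linarith
  have hfac_one (i : Fin (n + 2)) : (1 - α * μ i) ^ 2 ≤ 1 := by
    rcases eq_or_ne i 0 with rfl | hi
    · simp [hμ0]
    · exact (hfac hi).trans (pow_le_one₀ (by linarith) (by linarith))
  have hE (X : Matrix (Fin (n + 2)) (Fin (p + 1)) ℝ) :
      trace (Xᵀ * L * X) = ∑ i, μ i * ∑ j, (Uᵀ * X) i j ^ 2 := by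
    rw [hLdiag, trace_transpose_mul_diagonal_conj]
  have hφ (X : Matrix (Fin (n + 2)) (Fin (p + 1)) ℝ) (i) :
      ∑ j, (Uᵀ * ((1 - α • L) * X) : Matrix _ (Fin (p + 1)) ℝ) i j ^ 2 =
        (1 - α * μ i) ^ 2 * ∑ j, (Uᵀ * X) i j ^ 2 := by
    simp only [transpose_mul_one_sub_smul_mul_apply hU hLdiag, mul_pow, Finset.mul_sum]
  have hbasis (i : Fin (n + 2)) :
      Uᵀ * (U * single i (0 : Fin (p + 1)) (1 : ℝ)) = single i 0 1 := by
    rw [← Matrix.mul_assoc, hU, Matrix.one_mul]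
  refine ⟨α, ⟨hα0, hα1⟩, rfl, fun X => ?_, ⟨?_, ?_⟩, ⟨?_, ?_⟩, ?_⟩
  · rw [hLdef]
    simp only [Matrix.mul_add, Matrix.add_mul, Matrix.sub_mul, Matrix.smul_mul, Matrix.one_mul]
    module
  · refine ⟨U * single (1 : Fin (n + 2)) (0 : Fin (p + 1)) (1 : ℝ), ?_, ?_⟩
    · rw [hE]
      simp [hbasis, sum_single_sq, hμ2.ne']
    · rw [hE, hE]
      simp [hφ, hbasis, sum_single_sq, hμ2.ne', hαμ]
  · rintro r ⟨X, hX, rfl⟩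
    have hpos : 0 ≤ trace (Xᵀ * L * X) := by
      rw [hE]
      exact Finset.sum_nonneg fun i _ => mul_nonneg (hμ_nonneg i) (by positivity)
    rw [div_le_iff₀ (hpos.lt_of_ne' hX), hE, hE, Finset.mul_sum]
    refine Finset.sum_le_sum fun i _ => ?_
    rw [hφ, mul_left_comm]
    rcases eq_or_ne i 0 with rfl | hi
    · simp [hμ0]
    · exact mul_le_mul_of_nonneg_right (hfac hi) (mul_nonneg (hμ_nonneg i) (by positivity))
  · refine ⟨U * single (0 : Fin (n + 2)) (0 : Fin (p + 1)) (1 : ℝ), fun h => ?_, ?_⟩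
    · have := congrFun₂ (hbasis 0) 0 0
      simp [h] at this
    · simp [frobNorm_sq_orthogonal hU', hφ, hbasis, sum_single_sq, hμ0]
  · rintro r ⟨X, -, rfl⟩
    refine div_le_one_of_le₀ ?_ (sq_nonneg _)
    rw [frobNorm_sq_orthogonal hU', frobNorm_sq_orthogonal hU']
    refine Finset.sum_le_sum fun i _ => ?_
    rw [hφ]
    exact mul_le_of_le_one_left (by positivity) (hfac_one i)
  · rw [div_one, Real.sqrt_sq (by linarith)]
    ring
end

section
/- Let M₀ and H be n×n real symmetric matrices. Suppose x : ℝ → ℝⁿ and λ : ℝ → ℝ are differentiable at 0, that (M₀ + tH) x(t) = λ(t) x(t) for all t in a neighborhood of 0, and that ‖x(t)‖ = 1 for all t in a neighborhood of 0. Then λ'(0) = x(0)ᵀ H x(0). Equivalently, λ'(0) = tr( (x(0) x(0)ᵀ) H ), i.e. the first-order change of the eigenvalue λ at M₀ in the direction H is given by the matrix x(0)x(0)ᵀ acting as gradient. -/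
open Matrix

theorem DifferentiableAt.const_dotProduct {ι : Type*} [Fintype ι] {x : ℝ → ι → ℝ} {t : ℝ}
    (hx : DifferentiableAt ℝ x t) (v : ι → ℝ) :
    DifferentiableAt ℝ (fun s => v ⬝ᵥ x s) t := by
  have hcoord := differentiableAt_pi.1 hx
  unfold dotProduct
  fun_prop

/-- Pairing the eigenvalue equation of `M + t • H` with an eigenvector of the symmetric
matrix `M` eliminates `M`. -/
theorem Matrix.IsSymm.mul_dotProduct_mulVec_eq {ι : Type*} [Fintype ι] {M H : Matrix ι ι ℝ}
    (hM : M.IsSymm) {u v : ι → ℝ} {a b t : ℝ} (hu : M *ᵥ u = a • u)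
    (hv : (M + t • H) *ᵥ v = b • v) :
    t * (u ⬝ᵥ H *ᵥ v) = (b - a) * (u ⬝ᵥ v) := by
  have hMv : u ⬝ᵥ M *ᵥ v = a * (u ⬝ᵥ v) := by
    rw [dotProduct_mulVec, ← mulVec_transpose, hM.eq, hu, smul_dotProduct, smul_eq_mul]
  have h := congrArg (u ⬝ᵥ ·) hv
  simp only [add_mulVec, smul_mulVec, dotProduct_add, dotProduct_smul, smul_eq_mul, hMv] at h
  linarith

/-- **first-order change of an eigenvalue of a symmetric matrix.**
Let `M₀` and `H` be `n × n` real symmetric matrices.  Suppose `x : ℝ → ℝⁿ` and `λ : ℝ → ℝ`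
are differentiable at `0`, that `(M₀ + t H) x(t) = λ(t) x(t)` for `t` near `0`, and
`‖x(t)‖ = 1` (i.e. `∑ i, x(t)ᵢ² = 1`) for `t` near `0`.  Then
`λ'(0) = x(0)ᵀ H x(0) = tr ((x(0) x(0)ᵀ) H)`. -/
theorem eigenvalue_derivative {n : ℕ}
    (M₀ H : Matrix (Fin n) (Fin n) ℝ)
    (hM₀ : M₀.IsSymm) (hH : H.IsSymm)
    (x : ℝ → (Fin n → ℝ)) (lam : ℝ → ℝ)
    (hx : DifferentiableAt ℝ x 0) (hlam : DifferentiableAt ℝ lam 0)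
    (heig : ∀ᶠ t in nhds 0, (M₀ + t • H).mulVec (x t) = lam t • x t)
    (hnorm : ∀ᶠ t in nhds 0, (∑ i, x t i ^ 2) = 1) :
    deriv lam 0 = x 0 ⬝ᵥ H.mulVec (x 0) ∧
    deriv lam 0 = Matrix.trace (Matrix.vecMulVec (x 0) (x 0) * H) := by
  have hunit : x 0 ⬝ᵥ x 0 = 1 := by
    simpa [dotProduct, sq] using hnorm.self_of_nhds
  have heig₀ : M₀ *ᵥ x 0 = lam 0 • x 0 := by
    simpa using heig.self_of_nhds
  have hpair : (fun t => t * (x 0 ⬝ᵥ H *ᵥ x t)) =ᶠ[nhds 0]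
      fun t => (lam t - lam 0) * (x 0 ⬝ᵥ x t) :=
    heig.mono fun t ht => hM₀.mul_dotProduct_mulVec_eq heig₀ ht
  have hleft : HasDerivAt (fun t => t * (x 0 ⬝ᵥ H *ᵥ x t)) (x 0 ⬝ᵥ H *ᵥ x 0) 0 := by
    have hd : DifferentiableAt ℝ (fun t => x 0 ⬝ᵥ H *ᵥ x t) 0 := by
      simpa only [dotProduct_mulVec] using hx.const_dotProduct (x 0 ᵥ* H)
    simpa using (hasDerivAt_id' (0 : ℝ)).fun_mul hd.hasDerivAt
  have hright : HasDerivAt (fun t => (lam t - lam 0) * (x 0 ⬝ᵥ x t)) (deriv lam 0) 0 := by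
    simpa [hunit] using
      (hlam.hasDerivAt.sub_const (lam 0)).fun_mul (hx.const_dotProduct (x 0)).hasDerivAt
  have hderiv : deriv lam 0 = x 0 ⬝ᵥ H *ᵥ x 0 :=
    hright.unique (hleft.congr_of_eventuallyEq hpair.symm)
  refine ⟨hderiv, ?_⟩
  rw [hderiv, vecMulVec_mul, trace_vecMulVec, dotProduct_mulVec, dotProduct_comm]
end
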